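/- arXiv:2005.03557 — 8 statements merged into one kernel-verified Lean document; each statement's English description precedes it below -/
import Mathlib

section
/- Let $\lambda > 0$, let $F : \mathbb{R}^p \to \mathbb{R}^{d\times d}$ assign to each $w$ a symmetric positive semidefinite matrix, and let $h : \mathbb{R}^p \to \mathbb{R}^d$. Suppose that for all $w, w'$: $\|F(w) - F(w')\| \le L_F\|w - w'\|$, $\|h(w)\| \le C_h$, and $\|h(w) - h(w')\| \le L_h\|w - w'\|$. Then for every $w$ the matrix $F(w) + \lambda I$ is invertible, and the map $\theta^{\lambda*}(w) := (F(w) + \lambda I)^{-1} h(w)$ satisfies $\|\theta^{\lambda*}(w) - \theta^{\lambda*}(w')\| \le \left(\frac{L_h}{\lambda} + \frac{C_h L_F}{\lambda^2}\right)\|w - w'\|$ for all $w, w'$. -/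
open scoped RealInnerProductSpace

section Regularized

variable {E : Type*} [NormedAddCommGroup E] [InnerProductSpace ℝ E]

theorem mul_norm_le_norm_add_smul_one_apply {T : E →L[ℝ] E} (hT : ∀ x, 0 ≤ ⟪x, T x⟫)
    (lam : ℝ) (x : E) : lam * ‖x‖ ≤ ‖(T + lam • (1 : E →L[ℝ] E)) x‖ := by
  rcases (norm_nonneg x).eq_or_lt with hx | hx
  · simp [← hx]
  · refine le_of_mul_le_mul_left ?_ hx
    calc ‖x‖ * (lam * ‖x‖) ≤ ⟪x, T x⟫ + lam * ‖x‖ ^ 2 := by linarith [hT x]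
      _ = ⟪x, (T + lam • (1 : E →L[ℝ] E)) x⟫ := by
        simp [inner_add_right, real_inner_smul_right]
      _ ≤ ‖x‖ * ‖(T + lam • (1 : E →L[ℝ] E)) x‖ := real_inner_le_norm _ _

theorem isUnit_add_smul_one [FiniteDimensional ℝ E] {T : E →L[ℝ] E}
    (hT : ∀ x, 0 ≤ ⟪x, T x⟫) {lam : ℝ} (hlam : 0 < lam) :
    IsUnit (T + lam • (1 : E →L[ℝ] E)) := by
  have : CompleteSpace E := FiniteDimensional.complete ℝ E
  have hinj : Function.Injective (T + lam • (1 : E →L[ℝ] E)) := by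
    refine (injective_iff_map_eq_zero _).2 fun x hx => ?_
    have hle := mul_norm_le_norm_add_smul_one_apply hT lam x
    rw [hx, norm_zero] at hle
    exact norm_le_zero_iff.1 (nonpos_of_mul_nonpos_right hle hlam)
  exact ContinuousLinearMap.isUnit_iff_bijective.2
    ⟨hinj, LinearMap.injective_iff_surjective.1 hinj⟩

theorem apply_inverse_apply_of_isUnit {A : E →L[ℝ] E} (hA : IsUnit A) (x : E) :
    A (Ring.inverse A x) = x := by
  rw [← mul_apply_eq_comp, Ring.mul_inverse_cancel A hA,
    one_apply_eq_self]

end Regularized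

/-- Lipschitz continuity of the regularized fixed point
`θ^{λ*}(w) = (F(w) + λI)⁻¹ h(w)` when `F` is Lipschitz, symmetric PSD valued,
and `h` is bounded and Lipschitz. -/
theorem regularized_fixed_point_lipschitz {d p : ℕ} (lam : ℝ) (hlam : 0 < lam)
    (F : EuclideanSpace ℝ (Fin p) → (EuclideanSpace ℝ (Fin d) →L[ℝ] EuclideanSpace ℝ (Fin d)))
    (h : EuclideanSpace ℝ (Fin p) → EuclideanSpace ℝ (Fin d))
    (LF Ch Lh : ℝ)
    (hsymm : ∀ w x y, ⟪F w x, y⟫ = ⟪x, F w y⟫)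
    (hpsd : ∀ w x, 0 ≤ ⟪x, F w x⟫)
    (hFlip : ∀ w w', ‖F w - F w'‖ ≤ LF * ‖w - w'‖)
    (hhbound : ∀ w, ‖h w‖ ≤ Ch)
    (hhlip : ∀ w w', ‖h w - h w'‖ ≤ Lh * ‖w - w'‖) :
    (∀ w, IsUnit (F w + lam • (1 : EuclideanSpace ℝ (Fin d) →L[ℝ] EuclideanSpace ℝ (Fin d)))) ∧
    (∀ w w', ‖Ring.inverse (F w + lam • 1) (h w) - Ring.inverse (F w' + lam • 1) (h w')‖ ≤
      (Lh / lam + Ch * LF / lam ^ 2) * ‖w - w'‖) := by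
  have hunit w :
      IsUnit (F w + lam • (1 : EuclideanSpace ℝ (Fin d) →L[ℝ] EuclideanSpace ℝ (Fin d))) :=
    isUnit_add_smul_one (hpsd w) hlam
  refine ⟨hunit, fun w w' => ?_⟩
  have hu := apply_inverse_apply_of_isUnit (hunit w) (h w)
  have hv := apply_inverse_apply_of_isUnit (hunit w') (h w')
  set u := Ring.inverse (F w + lam • 1) (h w)
  set v := Ring.inverse (F w' + lam • 1) (h w')
  have hv_norm : ‖v‖ ≤ Ch / lam := by
    rw [le_div_iff₀' hlam]
    refine (mul_norm_le_norm_add_smul_one_apply (hpsd w') lam v).trans ?_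
    rw [hv]
    exact hhbound w'
  have hdiff :
      (F w + lam • (1 : EuclideanSpace ℝ (Fin d) →L[ℝ] EuclideanSpace ℝ (Fin d))) (u - v) =
        (h w - h w') - (F w - F w') v := by
    rw [map_sub, hu, ← hv]
    simp only [add_apply, sub_apply]
    abel
  have hbound : lam * ‖u - v‖ ≤ Lh * ‖w - w'‖ + LF * ‖w - w'‖ * (Ch / lam) :=
    calc lam * ‖u - v‖
        ≤ ‖(h w - h w') - (F w - F w') v‖ :=
          hdiff ▸ mul_norm_le_norm_add_smul_one_apply (hpsd w) lam (u - v)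
      _ ≤ ‖h w - h w'‖ + ‖F w - F w'‖ * ‖v‖ :=
          (norm_sub_le _ _).trans (by gcongr; exact (F w - F w').le_opNorm v)
      _ ≤ Lh * ‖w - w'‖ + LF * ‖w - w'‖ * (Ch / lam) :=
          add_le_add (hhlip w w') (mul_le_mul (hFlip w w') hv_norm (norm_nonneg _)
            ((norm_nonneg _).trans (hFlip w w')))
  refine le_of_mul_le_mul_left (hbound.trans_eq ?_) hlam
  field_simp
end

section
/- Consider sequences $(\theta_t)_{t\ge0}$ and $(\theta^\ast_t)_{t\ge0}$ in $\mathbb{R}^d$, a nonincreasing sequence of positive reals $(\beta_t)_{t\ge0}$, a sequence of positive reals $(\alpha_t)_{t\ge0}$, and constants $a, C, c, \kappa > 0$ such that for every $t$: $\|\theta_{t+1} - \theta_t\| \le \beta_t\,(a\|\theta_t - \theta^\ast_t\| + C)$, $\|\theta^\ast_{t+1} - \theta^\ast_t\| \le c\,\alpha_t$, and $\alpha_t \le \kappa\,\beta_t$. Set $C_4 = C + c\kappa$. Then for every $t$ and every integer $\tau$ with $1 \le \tau \le t$ and $a\,\beta_{t-\tau}\,\tau^2 \le 1/4$, it holds that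 $\|\theta_t - \theta^\ast_t\| \le (1 + 2a\,\beta_{t-\tau}\,\tau)\,\|\theta_{t-\tau} - \theta^\ast_{t-\tau}\| + 2C_4\,\beta_{t-\tau}\,\tau$. -/
/-- A linear discrete Grönwall inequality: the compounded growth over `n` steps is at most twice
the first-order growth as long as `2 * x * n ≤ 1`. -/
theorem le_linear_of_affine_recursion {e : ℕ → ℝ} {x y : ℝ} (he : 0 ≤ e 0) (hx : 0 ≤ x)
    (hy : 0 ≤ y) (hrec : ∀ k, e (k + 1) ≤ (1 + x) * e k + y) (n : ℕ) (hn : 2 * x * n ≤ 1) :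
    e n ≤ (1 + 2 * x * n) * e 0 + 2 * y * n := by
  induction n with
  | zero => simp
  | succ k ih =>
    push_cast at hn ⊢
    have hk : 2 * x * k ≤ 1 := by linarith
    have hmul := mul_le_mul_of_nonneg_left (ih hk) (add_nonneg zero_le_one hx)
    have hxe := mul_le_mul_of_nonneg_left hk (mul_nonneg hx he)
    have hye := mul_le_mul_of_nonneg_left hk hy
    linarith [hrec k]

/-- paper's Lemma 6. One-step-to-`τ`-step bound for the critic tracking
error: if the critic moves by at most `β_t (a‖θ_t - θ*_t‖ + C)`, the fixed point drifts by at
most `c α_t`, and `α_t ≤ κ β_t`, then with `C₄ = C + cκ`, whenever `1 ≤ τ ≤ t` and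
`a β_{t-τ} τ² ≤ 1/4`,
`‖θ_t - θ*_t‖ ≤ (1 + 2 a β_{t-τ} τ)‖θ_{t-τ} - θ*_{t-τ}‖ + 2 C₄ β_{t-τ} τ`. -/
theorem tracking_error_tau_step_bound {d : ℕ}
    (θ θs : ℕ → EuclideanSpace ℝ (Fin d)) (β α : ℕ → ℝ)
    (a C c κ : ℝ) (ha : 0 < a) (hC : 0 < C) (hc : 0 < c) (hκ : 0 < κ)
    (hβpos : ∀ t, 0 < β t) (hβmono : ∀ s t, s ≤ t → β t ≤ β s)
    (hαpos : ∀ t, 0 < α t)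
    (hstep : ∀ t, ‖θ (t + 1) - θ t‖ ≤ β t * (a * ‖θ t - θs t‖ + C))
    (hdrift : ∀ t, ‖θs (t + 1) - θs t‖ ≤ c * α t)
    (hαβ : ∀ t, α t ≤ κ * β t)
    (C4 : ℝ) (hC4 : C4 = C + c * κ) :
    ∀ t τ : ℕ, 1 ≤ τ → τ ≤ t → a * β (t - τ) * (τ : ℝ) ^ 2 ≤ 1 / 4 →
      ‖θ t - θs t‖ ≤ (1 + 2 * a * β (t - τ) * (τ : ℝ)) * ‖θ (t - τ) - θs (t - τ)‖ +
        2 * C4 * β (t - τ) * (τ : ℝ) := by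
  intro t τ hτ hτt hsmall
  subst hC4
  obtain ⟨s, rfl⟩ := Nat.exists_eq_add_of_le' hτt
  rw [Nat.add_sub_cancel] at hsmall ⊢
  have hb := hβpos s
  have hx : 0 ≤ a * β s := by positivity
  have hrec : ∀ k, ‖θ (s + (k + 1)) - θs (s + (k + 1))‖ ≤
      (1 + a * β s) * ‖θ (s + k) - θs (s + k)‖ + (C + c * κ) * β s := by
    intro k
    have htri : ‖θ (s + k + 1) - θs (s + k + 1)‖ ≤ ‖θ (s + k + 1) - θ (s + k)‖ +
        ‖θ (s + k) - θs (s + k)‖ + ‖θs (s + k + 1) - θs (s + k)‖ := by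
      calc _ = ‖(θ (s + k + 1) - θ (s + k)) + (θ (s + k) - θs (s + k)) -
            (θs (s + k + 1) - θs (s + k))‖ := by congr 1; abel
        _ ≤ _ := (norm_sub_le _ _).trans (add_le_add_left (norm_add_le _ _) _)
    have hβ := hβmono s (s + k) (Nat.le_add_right s k)
    have hθ : β (s + k) * (a * ‖θ (s + k) - θs (s + k)‖ + C) ≤
        β s * (a * ‖θ (s + k) - θs (s + k)‖ + C) := by gcongr
    have hα : c * α (s + k) ≤ c * (κ * β s) := by
      gcongr
      exact (hαβ _).trans (by gcongr)
    rw [← add_assoc]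
    linarith [hstep (s + k), hdrift (s + k)]
  have hτ1 : (1 : ℝ) ≤ τ := by exact_mod_cast hτ
  have hτsq : a * β s * (τ : ℝ) ≤ a * β s * (τ : ℝ) ^ 2 :=
    mul_le_mul_of_nonneg_left (le_self_pow₀ hτ1 two_ne_zero) hx
  have h := le_linear_of_affine_recursion (e := fun k => ‖θ (s + k) - θs (s + k)‖)
    (norm_nonneg _) hx (by positivity) hrec τ (by linarith)
  simpa only [add_zero, mul_assoc] using h
end

section
/- Consider sequences $(\theta_t)_{t\ge0}$ and $(\theta^\ast_t)_{t\ge0}$ in $\mathbb{R}^d$, a nonincreasing sequence of positive reals $(\beta_t)_{t\ge0}$, a sequence of positive reals $(\alpha_t)_{t\ge0}$, and constants $a, C, c, \kappa > 0$ such that for every $t$: $\|\theta_{t+1} - \theta_t\| \le \beta_t\,(a\|\theta_t - \theta^\ast_t\| + C)$, $\|\theta^\ast_{t+1} - \theta^\ast_t\| \le c\,\alpha_t$, and $\alpha_t \le \kappa\,\beta_t$. Set $C_4 = C + c\kappa$ and $C_5 = \tfrac{1}{2}C_4 + C$. Then for every $t$ and every integer $\tau$ with $1 \le \tau \le t$ and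 $a\,\beta_{t-\tau}\,\tau^2 \le 1/4$, it holds that $\|\theta_t - \theta_{t-\tau}\| \le \tfrac{3}{2}\,a\,\beta_{t-\tau}\,\tau\,\|\theta_{t-\tau} - \theta^\ast_{t-\tau}\| + C_5\,\beta_{t-\tau}\,\tau$. -/
/-- A discrete Grönwall bound, linear in `n` as long as the growth `x * n` stays small. -/
theorem le_linear_of_le_one_add_mul_add {u : ℕ → ℝ} {x y : ℝ} {N : ℕ} (hx : 0 ≤ x) (hy : 0 ≤ y)
    (hu₀ : 0 ≤ u 0) (hu : ∀ n, u (n + 1) ≤ (1 + x) * u n + y) (hN : x * N ≤ 1 / 2) :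
    ∀ n ≤ N, u n ≤ (1 + 2 * n * x) * u 0 + 2 * n * y := by
  intro n
  induction n with
  | zero => simp
  | succ n ih =>
    intro hn
    have hnN : (n : ℝ) ≤ N := by exact_mod_cast (Nat.le_succ n).trans hn
    have hxn : 0 ≤ 1 - 2 * (x * n) := by
      linarith [mul_le_mul_of_nonneg_left hnN hx]
    push_cast
    calc u (n + 1) ≤ (1 + x) * u n + y := hu n
      _ ≤ (1 + x) * ((1 + 2 * n * x) * u 0 + 2 * n * y) + y := by
        gcongr
        exact ih (by lia)
      _ ≤ (1 + 2 * (n + 1) * x) * u 0 + 2 * (n + 1) * y := by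
        linarith [mul_nonneg hxn (mul_nonneg hx hu₀), mul_nonneg hxn hy]

theorem norm_sub_le_nat_mul {E : Type*} [SeminormedAddCommGroup E] {v : ℕ → E} {K : ℝ} {N : ℕ}
    (hv : ∀ n < N, ‖v (n + 1) - v n‖ ≤ K) : ‖v N - v 0‖ ≤ N * K := by
  rw [← Finset.sum_range_sub v N, ← nsmul_eq_mul]
  simpa using norm_sum_le_of_le (Finset.range N) fun n hn => hv n (Finset.mem_range.mp hn)


/-- paper's Lemma 7. Bound on the `τ`-step movement of the critic iterate:
under the same hypotheses as Lemma 6, with `C₄ = C + cκ` and `C₅ = C₄/2 + C`, whenever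
`1 ≤ τ ≤ t` and `a β_{t-τ} τ² ≤ 1/4`,
`‖θ_t - θ_{t-τ}‖ ≤ (3/2) a β_{t-τ} τ ‖θ_{t-τ} - θ*_{t-τ}‖ + C₅ β_{t-τ} τ`. -/
theorem critic_iterate_movement_bound {d : ℕ}
    (θ θs : ℕ → EuclideanSpace ℝ (Fin d)) (β α : ℕ → ℝ)
    (a C c κ : ℝ) (ha : 0 < a) (hC : 0 < C) (hc : 0 < c) (hκ : 0 < κ)
    (hβpos : ∀ t, 0 < β t) (hβmono : ∀ s t, s ≤ t → β t ≤ β s)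
    (hαpos : ∀ t, 0 < α t)
    (hstep : ∀ t, ‖θ (t + 1) - θ t‖ ≤ β t * (a * ‖θ t - θs t‖ + C))
    (hdrift : ∀ t, ‖θs (t + 1) - θs t‖ ≤ c * α t)
    (hαβ : ∀ t, α t ≤ κ * β t)
    (C4 C5 : ℝ) (hC4 : C4 = C + c * κ) (hC5 : C5 = (1 / 2) * C4 + C) :
    ∀ t τ : ℕ, 1 ≤ τ → τ ≤ t → a * β (t - τ) * (τ : ℝ) ^ 2 ≤ 1 / 4 →
      ‖θ t - θ (t - τ)‖ ≤ (3 / 2) * a * β (t - τ) * (τ : ℝ) * ‖θ (t - τ) - θs (t - τ)‖ +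
        C5 * β (t - τ) * (τ : ℝ) := by
  intro t τ hτ hτt hsmall
  obtain ⟨s, rfl⟩ := Nat.exists_eq_add_of_le' hτt
  rw [Nat.add_sub_cancel] at hsmall ⊢
  have hb := hβpos s
  have hτ1 : (1 : ℝ) ≤ τ := by exact_mod_cast hτ
  have hx : 0 < a * β s := mul_pos ha hb
  have hxτ : a * β s * τ ≤ 1 / 4 := by
    refine le_trans ?_ hsmall
    gcongr
    exact le_self_pow₀ hτ1 two_ne_zero
  have hC4pos : 0 < C4 := hC4 ▸ by positivity
  have hstep' (n : ℕ) : ‖θ (s + n + 1) - θ (s + n)‖ ≤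
      β s * (a * ‖θ (s + n) - θs (s + n)‖ + C) :=
    (hstep _).trans (by gcongr; exact hβmono _ _ (Nat.le_add_right s n))
  have hdrift' (n : ℕ) : ‖θs (s + n + 1) - θs (s + n)‖ ≤ c * (κ * β s) :=
    (hdrift _).trans (by
      gcongr
      exact (hαβ _).trans (by gcongr; exact hβmono _ _ (Nat.le_add_right s n)))
  have herror := le_linear_of_le_one_add_mul_add
    (u := fun n => ‖θ (s + n) - θs (s + n)‖) (x := a * β s) (y := β s * C4) (N := τ)
    hx.le (by positivity) (norm_nonneg _) (fun n => by
      have hsplit : θ (s + n + 1) - θs (s + n + 1) =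
          (θ (s + n + 1) - θ (s + n)) + (θ (s + n) - θs (s + n)) -
            (θs (s + n + 1) - θs (s + n)) := by abel
      have h₁ := norm_sub_le ((θ (s + n + 1) - θ (s + n)) + (θ (s + n) - θs (s + n)))
        (θs (s + n + 1) - θs (s + n))
      have h₂ := norm_add_le (θ (s + n + 1) - θ (s + n)) (θ (s + n) - θs (s + n))
      rw [← hsplit] at h₁
      simp only [← add_assoc, hC4]
      linarith [hstep' n, hdrift' n]) (by linarith)
  have hmove := norm_sub_le_nat_mul (v := fun n => θ (s + n)) (N := τ)
    (K := β s * ((3 / 2) * a * ‖θ s - θs s‖ + C5)) fun n hn => by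
      have hnτ : a * β s * n ≤ 1 / 4 :=
        le_trans (by gcongr) hxτ
      refine (hstep' n).trans (mul_le_mul_of_nonneg_left ?_ hb.le)
      have hD := mul_le_mul_of_nonneg_left (herror n hn.le) ha.le
      simp only [add_zero] at hD
      have h₁ := mul_le_mul_of_nonneg_right hnτ (mul_nonneg ha.le (norm_nonneg (θ s - θs s)))
      have h₂ := mul_le_mul_of_nonneg_right hnτ hC4pos.le
      rw [hC5]
      linarith
  simp only [add_zero] at hmove
  linarith
end

section
/- Consider sequences $(\theta_t)_{t\ge0}$ and $(\theta^\ast_t)_{t\ge0}$ in $\mathbb{R}^d$, a nonincreasing sequence of positive reals $(\beta_t)_{t\ge0}$ with $\beta_t \le \beta_0$, a sequence of positive reals $(\alpha_t)_{t\ge0}$ with $\alpha_t \le \alpha_0$, and constants $a, C, c, \kappa > 0$ such that for every $t$: $\|\theta_{t+1} - \theta_t\| \le \beta_t\,(a\|\theta_t - \theta^\ast_t\| + C)$, $\|\theta^\ast_{t+1} - \theta^\ast_t\| \le c\,\alpha_t$, and $\alpha_t \le \kappa\,\beta_t$. Set $C_4 = C + c\kappa$ and $C_5 = \tfrac{1}{2}C_4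 + C$. Then for every integer $\hat{t} \ge 1$ with $a\,\beta_0\,\hat{t}^2 \le 1/4$: $\|\theta_{\hat t} - \theta^\ast_{\hat t}\|^2 \le \left(3 + \tfrac{27}{2}a^2\beta_0^2\hat{t}^2\right)\|\theta_0 - \theta^\ast_0\|^2 + 3c^2\alpha_0^2\hat{t}^2 + 6C_5^2\beta_0^2\hat{t}^2$. -/
/-- Discrete Gronwall bound with a linearized growth factor, valid while `2 * p * n ≤ 1`. -/
theorem le_linear_growth_of_le_one_add_mul_add {e : ℕ → ℝ} {p q : ℝ} (hp : 0 ≤ p) (hq : 0 ≤ q)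
    (he0 : 0 ≤ e 0) (he : ∀ t, e (t + 1) ≤ (1 + p) * e t + q) {n : ℕ}
    (hn : 2 * p * n ≤ 1) : e n ≤ (1 + 2 * p * n) * (e 0 + n * q) := by
  induction n with
  | zero => simp
  | succ t ih =>
    push_cast at hn ⊢
    have hpt : 2 * p * t ≤ 1 := by linarith
    have hgrowth : (1 + p) * (1 + 2 * p * t) ≤ 1 + 2 * p * (t + 1) := by
      linarith [mul_le_mul_of_nonneg_left hpt hp]
    calc e (t + 1) ≤ (1 + p) * e t + q := he t
      _ ≤ (1 + p) * ((1 + 2 * p * t) * (e 0 + t * q)) + q := by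
        gcongr
        exact ih hpt
      _ = (1 + p) * (1 + 2 * p * t) * (e 0 + t * q) + q := by ring
      _ ≤ (1 + 2 * p * (t + 1)) * (e 0 + t * q) + (1 + 2 * p * (t + 1)) * q := by
        gcongr
        exact le_mul_of_one_le_left hq (by linarith [show 0 ≤ 2 * p * (t + 1 : ℝ) by positivity])
      _ = (1 + 2 * p * (t + 1)) * (e 0 + (t + 1) * q) := by ring

/-- A sequence whose first `n` steps have length at most `K` moves by at most `n * K`. -/
theorem norm_sub_zero_le_mul_of_step_le {E : Type*} [SeminormedAddCommGroup E] {f : ℕ → E}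
    {K : ℝ} {n : ℕ} (h : ∀ t < n, ‖f (t + 1) - f t‖ ≤ K) : ‖f n - f 0‖ ≤ n * K := by
  have hsum := dist_le_range_sum_of_dist_le (f := f) n (d := fun _ => K)
    (fun {t} ht => by rw [dist_comm, dist_eq_norm]; exact h t ht)
  rwa [dist_comm, dist_eq_norm, Finset.sum_const, Finset.card_range, nsmul_eq_mul] at hsum

/-- The difference of two sequences changes in norm by at most the sum of their displacements. -/
theorem norm_sub_le_add_displacements {E : Type*} [SeminormedAddCommGroup E] (x y x' y' : E) :
    ‖x' - y'‖ ≤ ‖x - y‖ + ‖y' - y‖ + ‖x' - x‖ := by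
  calc ‖x' - y'‖ = ‖(x - y) - (y' - y) + (x' - x)‖ := by congr 1; abel
    _ ≤ ‖(x - y) - (y' - y)‖ + ‖x' - x‖ := norm_add_le _ _
    _ ≤ ‖x - y‖ + ‖y' - y‖ + ‖x' - x‖ := by gcongr; exact norm_sub_le _ _

/-- paper's Lemma 8. Bound on the tracking error at time `t̂` in terms of
the initial tracking error: with `C₄ = C + cκ` and `C₅ = C₄/2 + C`, for every integer
`t̂ ≥ 1` with `a β₀ t̂² ≤ 1/4`,
`‖θ_{t̂} - θ*_{t̂}‖² ≤ (3 + (27/2) a² β₀² t̂²)‖θ₀ - θ*₀‖² + 3 c² α₀² t̂² + 6 C₅² β₀² t̂²`. -/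
theorem tracking_error_initial_bound {d : ℕ}
    (θ θs : ℕ → EuclideanSpace ℝ (Fin d)) (β α : ℕ → ℝ)
    (a C c κ : ℝ) (ha : 0 < a) (hC : 0 < C) (hc : 0 < c) (hκ : 0 < κ)
    (hβpos : ∀ t, 0 < β t) (hβmono : ∀ s t, s ≤ t → β t ≤ β s) (hβ0 : ∀ t, β t ≤ β 0)
    (hαpos : ∀ t, 0 < α t) (hα0 : ∀ t, α t ≤ α 0)
    (hstep : ∀ t, ‖θ (t + 1) - θ t‖ ≤ β t * (a * ‖θ t - θs t‖ + C))
    (hdrift : ∀ t, ‖θs (t + 1) - θs t‖ ≤ c * α t)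
    (hαβ : ∀ t, α t ≤ κ * β t)
    (C4 C5 : ℝ) (hC4 : C4 = C + c * κ) (hC5 : C5 = (1 / 2) * C4 + C) :
    ∀ that : ℕ, 1 ≤ that → a * β 0 * (that : ℝ) ^ 2 ≤ 1 / 4 →
      ‖θ that - θs that‖ ^ 2 ≤
        (3 + (27 / 2) * a ^ 2 * (β 0) ^ 2 * (that : ℝ) ^ 2) * ‖θ 0 - θs 0‖ ^ 2 +
          3 * c ^ 2 * (α 0) ^ 2 * (that : ℝ) ^ 2 + 6 * C5 ^ 2 * (β 0) ^ 2 * (that : ℝ) ^ 2 := by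
  intro n hn hsmall
  have hb : 0 < β 0 := hβpos 0
  have hC4nonneg : 0 ≤ C4 := by rw [hC4]; positivity
  have hn1 : (1 : ℝ) ≤ n := by exact_mod_cast hn
  have hab : 0 < a * β 0 := mul_pos ha hb
  have hstep0 : ∀ t, ‖θ (t + 1) - θ t‖ ≤ β 0 * (a * ‖θ t - θs t‖ + C) := fun t =>
    (hstep t).trans (mul_le_mul_of_nonneg_right (hβ0 t) (by positivity))
  have hrec : ∀ t, ‖θ (t + 1) - θs (t + 1)‖ ≤ (1 + a * β 0) * ‖θ t - θs t‖ + β 0 * C4 := by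
    intro t
    have hα : c * α t ≤ c * (κ * β 0) := by
      gcongr
      exact (hαβ t).trans (by gcongr; exact hβ0 t)
    rw [hC4]
    linarith [norm_sub_le_add_displacements (θ t) (θs t) (θ (t + 1)) (θs (t + 1)),
      hstep0 t, hdrift t]
  have hdispl : ‖θ n - θ 0‖ ≤ n * (β 0 * (3 / 2 * a * ‖θ 0 - θs 0‖ + C5)) := by
    refine norm_sub_zero_le_mul_of_step_le fun t ht => (hstep0 t).trans ?_
    have htn : (t : ℝ) ≤ n := by exact_mod_cast ht.le
    have habt : a * β 0 * t ≤ 1 / 4 :=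
      (mul_le_mul_of_nonneg_left (by nlinarith) hab.le).trans hsmall
    have herr := le_linear_growth_of_le_one_add_mul_add (e := fun t => ‖θ t - θs t‖) hab.le
      (mul_nonneg hb.le hC4nonneg) (norm_nonneg _) hrec (n := t) (by linarith)
    have herr' : ‖θ t - θs t‖ ≤ 3 / 2 * (‖θ 0 - θs 0‖ + t * (β 0 * C4)) :=
      herr.trans (mul_le_mul_of_nonneg_right (by linarith) (by positivity))
    have hCt := mul_le_mul_of_nonneg_right habt hC4nonneg
    rw [hC5]
    refine mul_le_mul_of_nonneg_left ?_ hb.le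
    linarith [mul_le_mul_of_nonneg_left herr' ha.le]
  have hdrifts : ‖θs n - θs 0‖ ≤ n * (c * α 0) :=
    norm_sub_zero_le_mul_of_step_le fun t _ => (hdrift t).trans (by gcongr; exact hα0 t)
  have htotal := (norm_sub_le_add_displacements (θ 0) (θs 0) (θ n) (θs n)).trans
    (add_le_add (add_le_add le_rfl hdrifts) hdispl)
  set x := ‖θ 0 - θs 0‖
  set y := n * (c * α 0) with hy
  set z := n * (β 0 * (3 / 2 * a * x + C5)) with hz
  calc ‖θ n - θs n‖ ^ 2 ≤ (x + y + z) ^ 2 := by gcongr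
    _ ≤ 3 * x ^ 2 + 3 * y ^ 2 + 3 * z ^ 2 := by
      linarith [sq_nonneg (x - y), sq_nonneg (y - z), sq_nonneg (x - z)]
    _ ≤ _ := by
      rw [hy, hz]
      linarith [sq_nonneg (n * β 0 * (3 / 2 * a * x - C5))]
end

section
/- Let $(X, \mathcal{F})$ be a measurable space, and for each $w \in \mathbb{R}^p$ let $\mu_w$ be a probability measure on $X$ with $d_{TV}(\mu_w, \mu_{w'}) \le C_\nu\|w - w'\|$ for all $w, w'$. Let $\phi : \mathbb{R}^p \times X \to \mathbb{R}^d$ be measurable in $x$ with $\|\phi(w,x)\| \le C_\phi$ and $\|\phi(w,x) - \phi(w',x)\| \le L_\phi\|w - w'\|$ for all $w, w', x$. Then for all $w, w'$: $\left\|\int_X \phi(w,x)\phi(w,x)^\top\, d\mu_w(x) - \int_X \phi(w',x)\phi(w',x)^\top\, d\mu_{w'}(x)\right\| \le 2\,(C_\phi^2 C_\nu + C_\phi L_\phi)\,\|w - w'\|$. -/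
open MeasureTheory

/-- Total-variation distance between two measures: `sup_B |μ(B) - ν(B)|` over
measurable sets `B`. -/
noncomputable def tvDist {X : Type*} [MeasurableSpace X] (μ ν : Measure X) : ℝ :=
  ⨆ B : {B : Set X // MeasurableSet B}, |(μ B.1).toReal - (ν B.1).toReal|

theorem abs_measureReal_sub_le_tvDist {X : Type*} [MeasurableSpace X] (μ ν : Measure X)
    [IsFiniteMeasure μ] [IsFiniteMeasure ν] {B : Set X} (hB : MeasurableSet B) :
    |μ.real B - ν.real B| ≤ tvDist μ ν := by
  refine le_ciSup (f := fun B : {B : Set X // MeasurableSet B} =>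
    |(μ B.1).toReal - (ν B.1).toReal|) ⟨μ.real Set.univ + ν.real Set.univ, ?_⟩ ⟨B, hB⟩
  rintro _ ⟨A, rfl⟩
  have hμ : μ.real A.1 ≤ μ.real Set.univ := measureReal_mono (Set.subset_univ _)
  have hν : ν.real A.1 ≤ ν.real Set.univ := measureReal_mono (Set.subset_univ _)
  have hμ0 : 0 ≤ μ.real A.1 := measureReal_nonneg
  have hν0 : 0 ≤ ν.real A.1 := measureReal_nonneg
  change |μ.real A.1 - ν.real A.1| ≤ _
  rw [abs_le]
  constructor <;> linarith

/-- Layer-cake bound for functions with values in `[0, M]`. -/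
theorem abs_integral_sub_integral_le_mul_tvDist {X : Type*} [MeasurableSpace X] (μ ν : Measure X)
    [IsFiniteMeasure μ] [IsFiniteMeasure ν] {f : X → ℝ} (hf : Measurable f) {M : ℝ} (hM : 0 ≤ M)
    (hf0 : ∀ x, 0 ≤ f x) (hfM : ∀ x, f x ≤ M) :
    |(∫ x, f x ∂μ) - ∫ x, f x ∂ν| ≤ M * tvDist μ ν := by
  have hint (ρ : Measure X) [IsFiniteMeasure ρ] : Integrable f ρ :=
    .of_bound hf.aestronglyMeasurable M
      (.of_forall fun x => by rw [Real.norm_of_nonneg (hf0 x)]; exact hfM x)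
  have hlevel (ρ : Measure X) [IsFiniteMeasure ρ] :
      IntegrableOn (fun t => ρ.real {x | t ≤ f x}) (Set.Ioc 0 M) := by
    have hanti : Antitone fun t => ρ.real {x | t ≤ f x} := fun s t hst =>
      measureReal_mono fun x (hx : t ≤ f x) => hst.trans hx
    exact (hanti.locallyIntegrable.integrableOn_isCompact isCompact_Icc).mono_set
      Set.Ioc_subset_Icc_self
  rw [(hint μ).integral_eq_integral_Ioc_meas_le (.of_forall hf0) (.of_forall hfM),
    (hint ν).integral_eq_integral_Ioc_meas_le (.of_forall hf0) (.of_forall hfM),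
    ← integral_sub (hlevel μ) (hlevel ν), ← Real.norm_eq_abs]
  refine (norm_setIntegral_le_of_norm_le_const (C := tvDist μ ν) (by simp) fun t _ =>
    abs_measureReal_sub_le_tvDist μ ν (measurableSet_le measurable_const hf)).trans_eq ?_
  simp [hM, mul_comm]

theorem norm_integral_sub_integral_le_mul_tvDist {X E : Type*} [MeasurableSpace X]
    [NormedAddCommGroup E] [NormedSpace ℝ E] [CompleteSpace E] (μ ν : Measure X)
    [IsProbabilityMeasure μ] [IsProbabilityMeasure ν] {f : X → E} (hf : StronglyMeasurable f)
    {M : ℝ} (hM : 0 ≤ M) (hfM : ∀ x, ‖f x‖ ≤ M) :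
    ‖(∫ x, f x ∂μ) - ∫ x, f x ∂ν‖ ≤ 2 * M * tvDist μ ν := by
  have htv : 0 ≤ tvDist μ ν := Real.iSup_nonneg fun _ => abs_nonneg _
  have hint (ρ : Measure X) [IsProbabilityMeasure ρ] : Integrable f ρ :=
    .of_bound hf.aestronglyMeasurable M (.of_forall hfM)
  refine NormedSpace.norm_le_dual_bound ℝ _ (by positivity) fun g => ?_
  have hg (x : X) : |g (f x)| ≤ ‖g‖ * M := (g.le_opNorm _).trans (by gcongr; exact hfM x)
  have hgm : Measurable fun x => g (f x) := (g.continuous.comp_stronglyMeasurable hf).measurable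
  have key := abs_integral_sub_integral_le_mul_tvDist μ ν (f := fun x => g (f x) + ‖g‖ * M)
    (hgm.add_const _) (M := 2 * M * ‖g‖) (by positivity)
    (fun x => by linarith [(abs_le.mp (hg x)).1]) (fun x => by linarith [(abs_le.mp (hg x)).2])
  rw [integral_add (g.integrable_comp (hint μ)) (integrable_const _),
    integral_add (g.integrable_comp (hint ν)) (integrable_const _)] at key
  simp only [integral_const, probReal_univ, one_smul, add_sub_add_right_eq_sub] at key
  rw [map_sub, ← g.integral_comp_comm (hint μ), ← g.integral_comp_comm (hint ν), Real.norm_eq_abs]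
  exact key.trans_eq (by ring)

theorem norm_outerProduct_sub_le {E : Type*} [NormedAddCommGroup E] [InnerProductSpace ℝ E]
    (a b : E) :
    ‖(innerSL ℝ a).smulRight a - (innerSL ℝ b).smulRight b‖ ≤ (‖a‖ + ‖b‖) * ‖a - b‖ := by
  have h : (innerSL ℝ a).smulRight a - (innerSL ℝ b).smulRight b =
      (innerSL ℝ a).smulRight (a - b) + (innerSL ℝ (a - b)).smulRight b := by
    ext y
    simp [smul_sub, sub_smul]
  rw [h]
  refine (norm_add_le _ _).trans_eq ?_
  simp only [ContinuousLinearMap.norm_smulRight_apply, innerSL_apply_norm]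
  ring

/-- first part of the paper's Lemma 11. Lipschitz continuity of
`w ↦ ∫ φ(w,x)φ(w,x)ᵀ dμ_w(x)` in operator norm, when `μ_w` is TV-Lipschitz in `w` and
`φ` is bounded and Lipschitz. The outer product `φφᵀ` is the operator `y ↦ ⟪φ, y⟫ • φ`. -/
theorem expected_outer_product_lipschitz {d p : ℕ} {X : Type*} [MeasurableSpace X]
    (μ : EuclideanSpace ℝ (Fin p) → Measure X)
    (hprob : ∀ w, IsProbabilityMeasure (μ w))
    (Cν Cφ Lφ : ℝ)
    (hTV : ∀ w w', tvDist (μ w) (μ w') ≤ Cν * ‖w - w'‖)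
    (φ : EuclideanSpace ℝ (Fin p) → X → EuclideanSpace ℝ (Fin d))
    (hmeas : ∀ w, Measurable (φ w))
    (hbound : ∀ w x, ‖φ w x‖ ≤ Cφ)
    (hlip : ∀ w w' x, ‖φ w x - φ w' x‖ ≤ Lφ * ‖w - w'‖) :
    ∀ w w', ‖(∫ x, (innerSL ℝ (φ w x)).smulRight (φ w x) ∂(μ w)) -
        ∫ x, (innerSL ℝ (φ w' x)).smulRight (φ w' x) ∂(μ w')‖ ≤
      2 * (Cφ ^ 2 * Cν + Cφ * Lφ) * ‖w - w'‖ := by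
  intro w w'
  have := hprob w
  have := hprob w'
  obtain ⟨x₀⟩ : Nonempty X := (μ w).nonempty_of_neZero
  have hC : 0 ≤ Cφ := (norm_nonneg _).trans (hbound w x₀)
  let F (v : EuclideanSpace ℝ (Fin p)) (x : X) := (innerSL ℝ (φ v x)).smulRight (φ v x)
  have hFm (v) : StronglyMeasurable (F v) := by
    have hcont : Continuous fun a : EuclideanSpace ℝ (Fin d) => (innerSL ℝ a).smulRight a := by
      fun_prop
    exact hcont.comp_stronglyMeasurable (hmeas v).stronglyMeasurable
  have hFb (v x) : ‖F v x‖ ≤ Cφ ^ 2 := by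
    simp only [F, ContinuousLinearMap.norm_smulRight_apply, innerSL_apply_norm, ← sq]
    gcongr
    exact hbound v x
  have hFint (v) : Integrable (F v) (μ w') :=
    .of_bound (hFm v).aestronglyMeasurable (Cφ ^ 2) (.of_forall (hFb v))
  have hmeasure : ‖(∫ x, F w x ∂(μ w)) - ∫ x, F w x ∂(μ w')‖ ≤
      2 * Cφ ^ 2 * (Cν * ‖w - w'‖) :=
    (norm_integral_sub_integral_le_mul_tvDist _ _ (hFm w) (sq_nonneg Cφ) (hFb w)).trans
      (by gcongr; exact hTV w w')
  have hfeature : ‖(∫ x, F w x ∂(μ w')) - ∫ x, F w' x ∂(μ w')‖ ≤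
      (Cφ + Cφ) * (Lφ * ‖w - w'‖) := by
    rw [← integral_sub (hFint w) (hFint w')]
    refine (norm_integral_le_of_norm_le_const (C := (Cφ + Cφ) * (Lφ * ‖w - w'‖))
      (.of_forall fun x => (norm_outerProduct_sub_le _ _).trans ?_)).trans_eq (by simp)
    gcongr
    exacts [hbound w x, hbound w' x, hlip w w' x]
  refine (norm_sub_le_norm_sub_add_norm_sub _ (∫ x, F w x ∂(μ w')) _).trans ?_
  linarith
end

section
/- Let $0 < \nu < \sigma \le 1$ with $\sigma - \nu < 1$, let $C_\alpha, C_\beta, \lambda, A, B > 0$ with $\lambda C_\beta \le 1$, and set $\beta_t = C_\beta/(1+t)^\nu$ and $\alpha_t = C_\alpha/(1+t)^\sigma$ for integers $t \ge 0$. Let $\hat t \ge 1$ be an integer and let $(u_t)_{t\ge0}$ be nonnegative reals satisfying, for all $t \ge \hat t$: $u_{t+1} \le (1 - \lambda\beta_t)u_t + A\,\beta_t^2\,(1 + \log(1+t))^2 + B\,\alpha_t$. Then there exists a constant $D > 0$ such that for all integers $t \ge 1$: $u_t \le D\,\frac{(1 + \log(1+t))^2}{(1+t)^{\min(\nu,\,\sigma-\nu)}}$.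 -/
open Filter

/-- A discrete comparison principle: a sequence contracting by `1 - b t` with forcing `K * b t * v t`
is dominated by a multiple of `v`, provided `v` decays no faster than by factors `1 - b t / 2`. -/
theorem exists_forall_le_mul_of_contraction {u v b : ℕ → ℝ} {K : ℝ} {T : ℕ} (hK : 0 ≤ K)
    (hv : ∀ t, 0 < v t) (hb₀ : ∀ t, 0 ≤ b t) (hb₁ : ∀ t, b t ≤ 1)
    (hu : ∀ t, T ≤ t → u (t + 1) ≤ (1 - b t) * u t + K * b t * v t)
    (hvb : ∀ t, T ≤ t → (1 - b t / 2) * v t ≤ v (t + 1)) :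
    ∃ D : ℝ, 0 < D ∧ ∀ t, u t ≤ D * v t := by
  set S := ∑ i ∈ Finset.range (T + 1), |u i / v i|
  have hS₀ : 0 ≤ S := Finset.sum_nonneg fun i _ => abs_nonneg _
  have small : ∀ t, t ≤ T → u t ≤ (2 * K + 1 + S) * v t := by
    intro t ht
    rw [← div_le_iff₀ (hv t)]
    have h : |u t / v t| ≤ S := Finset.single_le_sum (f := fun i => |u i / v i|)
      (fun i _ => abs_nonneg _) (Finset.mem_range.2 (Nat.lt_succ_of_le ht))
    linarith [le_abs_self (u t / v t)]
  refine ⟨2 * K + 1 + S, by positivity, fun t => ?_⟩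
  rcases le_total t T with ht | ht
  · exact small t ht
  induction t, ht using Nat.le_induction with
  | base => exact small T le_rfl
  | succ t ht ih =>
    have h₁ := mul_le_mul_of_nonneg_left ih (sub_nonneg.2 (hb₁ t))
    have h₂ := mul_le_mul_of_nonneg_left (hvb t ht) (by positivity : 0 ≤ 2 * K + 1 + S)
    have h₃ : 0 ≤ (1 + S) * (b t * v t) :=
      mul_nonneg (by positivity) (mul_nonneg (hb₀ t) (hv t).le)
    nlinarith [hu t ht]

/-- The sequence `(1 + log s)² / s ^ m` with `m ≤ 1` decays no faster than by factors `1 - 1 / s`. -/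
theorem one_sub_inv_mul_log_sq_div_rpow_le {s m : ℝ} (hs : 1 ≤ s) (hm₁ : m ≤ 1) :
    (1 - 1 / s) * ((1 + Real.log s) ^ 2 / s ^ m) ≤
      (1 + Real.log (s + 1)) ^ 2 / (s + 1) ^ m := by
  have hs₀ : 0 < s := by linarith
  have hlog : 0 ≤ Real.log s := Real.log_nonneg hs
  have hlog' : Real.log s ≤ Real.log (s + 1) := Real.log_le_log hs₀ (by linarith)
  have hratio : (1 - 1 / s) * (s + 1) ^ m ≤ s ^ m := by
    have h₁ : 1 - 1 / s ≤ s / (s + 1) := by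
      rw [le_div_iff₀ (by positivity)]
      have : (1 - 1 / s) * (s + 1) = s - 1 / s := by field_simp; ring
      have : 0 < 1 / s := by positivity
      linarith
    have h₂ : s / (s + 1) ≤ (s / (s + 1)) ^ m :=
      Real.self_le_rpow_of_le_one (by positivity) (div_le_one_of_le₀ (by linarith) (by positivity))
        hm₁
    rw [Real.div_rpow hs₀.le (by positivity)] at h₂
    exact (le_div_iff₀ (by positivity)).1 (h₁.trans h₂)
  have hstep : (1 - 1 / s) / s ^ m ≤ 1 / (s + 1) ^ m := by
    rw [div_le_div_iff₀ (by positivity) (by positivity)]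
    linarith
  calc (1 - 1 / s) * ((1 + Real.log s) ^ 2 / s ^ m)
      = (1 + Real.log s) ^ 2 * ((1 - 1 / s) / s ^ m) := by ring
    _ ≤ (1 + Real.log s) ^ 2 * (1 / (s + 1) ^ m) := by gcongr
    _ ≤ (1 + Real.log (s + 1)) ^ 2 * (1 / (s + 1) ^ m) := by gcongr
    _ = _ := by ring

/-- For `ν < 1`, `1 / (1 + t)` is eventually below any positive multiple of `1 / (1 + t) ^ ν`. -/
theorem eventually_one_div_le_div_rpow {ν c : ℝ} (hν : ν < 1) (hc : 0 < c) :
    ∀ᶠ t : ℕ in atTop, 1 / (1 + (t : ℝ)) ≤ c / (1 + (t : ℝ)) ^ ν := by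
  have h : Tendsto (fun t : ℕ => (1 + (t : ℝ)) ^ (1 - ν)) atTop atTop :=
    (tendsto_rpow_atTop (sub_pos.2 hν)).comp
      (tendsto_atTop_add_const_left _ _ tendsto_natCast_atTop_atTop)
  filter_upwards [h.eventually_ge_atTop (1 / c)] with t ht
  have hs : 0 < 1 + (t : ℝ) := by positivity
  rw [Real.rpow_sub hs, Real.rpow_one, div_le_div_iff₀ hc (by positivity)] at ht
  rw [div_le_div_iff₀ hs (by positivity)]
  linarith


/-- analytic core of Steps 1–2 of the paper's Theorem 1. If the
nonnegative sequence `u_t` satisfies, for `t ≥ t̂`,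
`u_{t+1} ≤ (1 - λβ_t) u_t + A β_t² (1 + log(1+t))² + B α_t`
with two time-scale stepsizes `β_t = C_β/(1+t)^ν`, `α_t = C_α/(1+t)^σ`, `0 < ν < σ ≤ 1`,
`σ - ν < 1`, `λ C_β ≤ 1`, then there is a constant `D > 0` with
`u_t ≤ D (1 + log(1+t))² / (1+t)^{min(ν, σ-ν)}` for all `t ≥ 1`. -/
theorem two_timescale_tracking_error_rate (ν σ Cα Cβ lam A B : ℝ)
    (hν : 0 < ν) (hνσ : ν < σ) (hσ : σ ≤ 1) (hσν : σ - ν < 1)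
    (hCα : 0 < Cα) (hCβ : 0 < Cβ) (hlam : 0 < lam) (hA : 0 < A) (hB : 0 < B)
    (hlamCβ : lam * Cβ ≤ 1)
    (β α : ℕ → ℝ)
    (hβ : ∀ t : ℕ, β t = Cβ / (1 + (t : ℝ)) ^ ν)
    (hα : ∀ t : ℕ, α t = Cα / (1 + (t : ℝ)) ^ σ)
    (that : ℕ) (hthat : 1 ≤ that)
    (u : ℕ → ℝ) (hu : ∀ t, 0 ≤ u t)
    (hrec : ∀ t, that ≤ t →
      u (t + 1) ≤ (1 - lam * β t) * u t +
        A * β t ^ 2 * (1 + Real.log (1 + (t : ℝ))) ^ 2 + B * α t) :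
    ∃ D : ℝ, 0 < D ∧ ∀ t : ℕ, 1 ≤ t →
      u t ≤ D * (1 + Real.log (1 + (t : ℝ))) ^ 2 / (1 + (t : ℝ)) ^ min ν (σ - ν) := by
  set m := min ν (σ - ν)
  have hm₀ : 0 < m := lt_min hν (sub_pos.2 hνσ)
  have hmν : m ≤ ν := min_le_left _ _
  have hmσ : m ≤ σ - ν := min_le_right _ _
  have hν₁ : ν < 1 := hνσ.trans_le hσ
  have hc : 0 < lam * Cβ := mul_pos hlam hCβ
  have hs : ∀ t : ℕ, 1 ≤ 1 + (t : ℝ) := fun t => le_add_of_nonneg_right t.cast_nonneg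
  have hs₀ : ∀ t : ℕ, 0 < 1 + (t : ℝ) := fun t => one_pos.trans_le (hs t)
  have hlog : ∀ t : ℕ, 0 ≤ Real.log (1 + (t : ℝ)) := fun t => Real.log_nonneg (hs t)
  have hb : ∀ t : ℕ, lam * β t = lam * Cβ / (1 + (t : ℝ)) ^ ν := fun t => by
    rw [hβ, mul_div_assoc]
  obtain ⟨T, hT⟩ := eventually_atTop.1 (eventually_one_div_le_div_rpow hν₁ (half_pos hc))
  suffices h : ∃ D : ℝ, 0 < D ∧ ∀ t : ℕ,
      u t ≤ D * ((1 + Real.log (1 + (t : ℝ))) ^ 2 / (1 + (t : ℝ)) ^ m) by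
    obtain ⟨D, hD, h⟩ := h
    exact ⟨D, hD, fun t _ => by rw [mul_div_assoc]; exact h t⟩
  refine exists_forall_le_mul_of_contraction (u := u) (b := fun t => lam * β t)
    (v := fun t => (1 + Real.log (1 + (t : ℝ))) ^ 2 / (1 + (t : ℝ)) ^ m)
    (K := (A * Cβ ^ 2 + B * Cα) / (lam * Cβ)) (T := max T that) (by positivity)
    (fun t => by have := hs₀ t; have := hlog t; positivity)
    (fun t => by have := hs₀ t; rw [hb]; positivity)
    (fun t => by
      rw [hb]
      exact div_le_one_of_le₀ (hlamCβ.trans (Real.one_le_rpow (hs t) hν.le))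
        (Real.rpow_nonneg (hs₀ t).le _))
    (fun t ht => ?_) (fun t ht => ?_)
  · refine (hrec t ((le_max_right _ _).trans ht)).trans ?_
    simp only [hβ, hα]
    have hs₁ := hs t
    have hs₂ := hs₀ t
    have hl := hlog t
    set s := 1 + (t : ℝ)
    set L := 1 + Real.log s
    have hL₁ : 1 ≤ L ^ 2 := one_le_pow₀ (by linarith)
    have hpow : s ^ (ν + m) = s ^ ν * s ^ m := Real.rpow_add hs₂ _ _
    have hvar : A * (Cβ / s ^ ν) ^ 2 * L ^ 2 ≤ A * Cβ ^ 2 * L ^ 2 / s ^ (ν + m) := by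
      have e : A * (Cβ / s ^ ν) ^ 2 * L ^ 2 = A * Cβ ^ 2 * L ^ 2 / s ^ (ν + ν) := by
        rw [Real.rpow_add hs₂]
        field_simp
      rw [e]
      have := Real.rpow_le_rpow_of_exponent_le hs₁ (by linarith : ν + m ≤ ν + ν)
      gcongr
    have hdrift : B * (Cα / s ^ σ) ≤ B * Cα * L ^ 2 / s ^ (ν + m) := by
      have := Real.rpow_le_rpow_of_exponent_le hs₁ (by linarith : ν + m ≤ σ)
      rw [← mul_div_assoc]
      exact div_le_div₀ (by positivity) (le_mul_of_one_le_right (by positivity) hL₁)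
        (by positivity) this
    have hforce : (A * Cβ ^ 2 + B * Cα) / (lam * Cβ) * (lam * (Cβ / s ^ ν)) * (L ^ 2 / s ^ m) =
        A * Cβ ^ 2 * L ^ 2 / s ^ (ν + m) + B * Cα * L ^ 2 / s ^ (ν + m) := by
      rw [hpow]
      field_simp
    linarith
  · have hstep := one_sub_inv_mul_log_sq_div_rpow_le (hs t) (hmν.trans hν₁.le)
    have hle := hT t ((le_max_left _ _).trans ht)
    have hcast : 1 + ((t + 1 : ℕ) : ℝ) = 1 + (t : ℝ) + 1 := by push_cast; ring
    have hs₂ := hs₀ t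
    simp only [hcast, hb]
    refine (mul_le_mul_of_nonneg_right ?_ (by positivity)).trans hstep
    rw [div_right_comm]
    linarith
end

section
/- Let $F$ be a real symmetric positive semidefinite $d\times d$ matrix, let $\mu > 0$ be such that $x^\top F x \ge \mu\|x\|^2$ for every $x$ in the range (column space) of $F$, let $\theta^\ast$ be a vector in the range of $F$, and set $b = F\theta^\ast$. Then for every $\lambda > 0$ the matrix $F + \lambda I$ is invertible and $\|(F + \lambda I)^{-1} b - \theta^\ast\| \le \frac{\lambda}{\mu + \lambda}\,\|\theta^\ast\|$. -/
open scoped RealInnerProductSpace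

section RegularizedInverse

variable {E : Type*} [NormedAddCommGroup E] [InnerProductSpace ℝ E]

theorem isUnit_add_smul_one_of_inner_nonneg [FiniteDimensional ℝ E] {F : E →L[ℝ] E}
    (hF : ∀ x, 0 ≤ ⟪x, F x⟫) {lam : ℝ} (hlam : 0 < lam) : IsUnit (F + lam • (1 : E →L[ℝ] E)) := by
  have hinj : Function.Injective (F + lam • (1 : E →L[ℝ] E)) := by
    rw [injective_iff_map_eq_zero]
    intro x hx
    have h : ⟪x, F x⟫ + lam * ‖x‖ ^ 2 = 0 := by
      have h := congrArg (fun y => ⟪x, y⟫) hx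
      simpa [inner_add_right, inner_smul_right] using h
    have hsq : ‖x‖ ^ 2 ≤ 0 := by nlinarith [hF x]
    simpa using le_antisymm hsq (sq_nonneg _)
  have := FiniteDimensional.complete ℝ E
  rw [ContinuousLinearMap.isUnit_iff_bijective]
  exact ⟨hinj, LinearMap.injective_iff_surjective (f := (F + lam • (1 : E →L[ℝ] E) : E →ₗ[ℝ] E)).1
    hinj⟩

/-- A solution of the regularized equation `(F + lam) x = F θ` with `θ` in the range of `F` is
close to `θ` if `F` is coercive on its range. -/
theorem norm_sub_le_of_add_smul_eq {F : E →L[ℝ] E} {μ : ℝ} (hμ : 0 < μ)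
    (hF : ∀ x ∈ Set.range F, μ * ‖x‖ ^ 2 ≤ ⟪x, F x⟫) {lam : ℝ} (hlam : 0 < lam) {x θ : E}
    (hθ : θ ∈ Set.range F) (hx : F x + lam • x = F θ) :
    ‖x - θ‖ ≤ lam / (μ + lam) * ‖θ‖ := by
  have hFe : F (x - θ) = -(lam • x) := by
    rw [map_sub, ← hx]
    abel
  have hmem : x - θ ∈ Set.range F := by
    obtain ⟨z, rfl⟩ := hθ
    refine ⟨-(lam⁻¹ • (x - F z)) - z, ?_⟩
    rw [map_sub, map_neg, map_smul, hFe, smul_neg, neg_neg, inv_smul_smul₀ hlam.ne']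
  have hcoer := hF _ hmem
  have hinner : ⟪x - θ, F (x - θ)⟫ = -(lam * ‖x - θ‖ ^ 2) - lam * ⟪x - θ, θ⟫ := by
    rw [hFe, ← real_inner_self_eq_norm_sq, inner_neg_right, inner_smul_right,
      inner_sub_right (x - θ) x θ]
    ring
  have hcs : -(‖x - θ‖ * ‖θ‖) ≤ ⟪x - θ, θ⟫ :=
    neg_le_of_abs_le (abs_real_inner_le_norm _ _)
  rw [div_mul_eq_mul_div, le_div_iff₀ (by positivity)]
  rcases (norm_nonneg (x - θ)).eq_or_lt with h0 | h0
  · rw [← h0, zero_mul]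
    positivity
  · refine le_of_mul_le_mul_left ?_ h0
    nlinarith [mul_le_mul_of_nonneg_left hcs hlam.le]

end RegularizedInverse

/-- matrix-analysis content of the paper's Lemma 15, regularization bias.
If `F` is symmetric PSD, `x ↦ ⟪x, F x⟫ ≥ μ‖x‖²` on the range of `F`, `θ*` lies in the
range of `F` and `b = F θ*`, then for every `λ > 0` the operator `F + λI` is invertible and
`‖(F + λI)⁻¹ b - θ*‖ ≤ (λ/(μ+λ)) ‖θ*‖`. -/
theorem regularization_bias_bound {d : ℕ}
    (F : EuclideanSpace ℝ (Fin d) →L[ℝ] EuclideanSpace ℝ (Fin d))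
    (μ : ℝ) (hμ : 0 < μ)
    (hsymm : ∀ x y, ⟪F x, y⟫ = ⟪x, F y⟫)
    (hpsd : ∀ x, 0 ≤ ⟪x, F x⟫)
    (hcoercive : ∀ x ∈ Set.range F, μ * ‖x‖ ^ 2 ≤ ⟪x, F x⟫)
    (θs : EuclideanSpace ℝ (Fin d)) (hθs : θs ∈ Set.range F)
    (b : EuclideanSpace ℝ (Fin d)) (hb : b = F θs) :
    ∀ lam : ℝ, 0 < lam →
      IsUnit (F + lam • (1 : EuclideanSpace ℝ (Fin d) →L[ℝ] EuclideanSpace ℝ (Fin d))) ∧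
      ‖Ring.inverse (F + lam • 1) b - θs‖ ≤ lam / (μ + lam) * ‖θs‖ := by
  intro lam hlam
  have hunit := isUnit_add_smul_one_of_inner_nonneg hpsd hlam
  refine ⟨hunit, norm_sub_le_of_add_smul_eq hμ hcoercive hlam hθs ?_⟩
  have h := congrArg (fun T => T b) (Ring.mul_inverse_cancel _ hunit)
  simpa [hb] using h
end

section
/- Let $(S, \mathcal{S})$ and $(A, \mathcal{A})$ be measurable spaces, let $K$ be a Markov kernel from $S \times A$ to $S$, let $\pi$ and $\pi'$ be Markov kernels from $S$ to $A$ with $d_{TV}(\pi(s), \pi'(s)) \le \delta$ for every $s \in S$, and let $\mu$ and $\nu$ be probability measures on $S$. Define the one-step distributions $\mu'(B) = \int_S \int_A K(s,a)(B)\, \pi(s)(da)\, \mu(ds)$ and $\nu'(B) = \int_S \int_A K(s,a)(B)\, \pi'(s)(da)\, \nu(ds)$ for measurable $B \subseteq S$. Then $d_{TV}(\mu', \nu') \le \delta + d_{TV}(\mu, \nu)$. -/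
open MeasureTheory

theorem tvDist_nonneg {X : Type*} [MeasurableSpace X] (μ ν : Measure X) : 0 ≤ tvDist μ ν :=
  Real.iSup_nonneg fun _ => abs_nonneg _

theorem tvDist_comm {X : Type*} [MeasurableSpace X] (μ ν : Measure X) :
    tvDist μ ν = tvDist ν μ := by
  simp only [tvDist, abs_sub_comm]

theorem measure_le_add_tvDist {X : Type*} [MeasurableSpace X] (μ ν : Measure X)
    [IsProbabilityMeasure μ] [IsProbabilityMeasure ν] {B : Set X} (hB : MeasurableSet B) :
    μ B ≤ ν B + ENNReal.ofReal (tvDist μ ν) := by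
  have hbdd : BddAbove (Set.range fun B : {B : Set X // MeasurableSet B} =>
      |(μ B.1).toReal - (ν B.1).toReal|) := by
    refine ⟨1, ?_⟩
    rintro _ ⟨B, rfl⟩
    exact abs_sub_le_of_nonneg_of_le ENNReal.toReal_nonneg measureReal_le_one
      ENNReal.toReal_nonneg measureReal_le_one
  have h : |(μ B).toReal - (ν B).toReal| ≤ tvDist μ ν := le_ciSup hbdd ⟨B, hB⟩
  rw [← ENNReal.ofReal_toReal (measure_ne_top μ B), ← ENNReal.ofReal_toReal (measure_ne_top ν B),
    ← ENNReal.ofReal_add ENNReal.toReal_nonneg (tvDist_nonneg μ ν)]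
  exact ENNReal.ofReal_le_ofReal (by linarith [le_abs_self ((μ B).toReal - (ν B).toReal)])

/-- Layer-cake comparison of the integrals of a `[0, 1]`-valued function. -/
theorem lintegral_le_add_tvDist {X : Type*} [MeasurableSpace X] (μ ν : Measure X)
    [IsProbabilityMeasure μ] [IsProbabilityMeasure ν] {f : X → ENNReal} (hf : Measurable f)
    (hf1 : ∀ x, f x ≤ 1) :
    ∫⁻ x, f x ∂μ ≤ ∫⁻ x, f x ∂ν + ENNReal.ofReal (tvDist μ ν) := by
  have layer_cake (ρ : Measure X) :
      ∫⁻ x, f x ∂ρ = ∫⁻ t in Set.Ioi (0 : ℝ), ρ {x | t < (f x).toReal} := by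
    rw [← lintegral_eq_lintegral_meas_lt ρ (Filter.Eventually.of_forall fun _ =>
      ENNReal.toReal_nonneg) hf.ennreal_toReal.aemeasurable]
    exact lintegral_congr fun x =>
      (ENNReal.ofReal_toReal ((hf1 x).trans_lt ENNReal.one_lt_top).ne).symm
  rw [layer_cake μ, layer_cake ν]
  calc ∫⁻ t in Set.Ioi (0 : ℝ), μ {x | t < (f x).toReal}
      ≤ ∫⁻ t in Set.Ioi (0 : ℝ), (ν {x | t < (f x).toReal} +
          (Set.Iio (1 : ℝ)).indicator (fun _ => ENNReal.ofReal (tvDist μ ν)) t) := by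
        refine lintegral_mono fun t => ?_
        by_cases ht : t < 1
        · rw [Set.indicator_of_mem (Set.mem_Iio.2 ht)]
          exact measure_le_add_tvDist μ ν (measurableSet_lt measurable_const hf.ennreal_toReal)
        · have hempty : {x | t < (f x).toReal} = ∅ := by
            ext x
            have := ENNReal.toReal_mono ENNReal.one_ne_top (hf1 x)
            simp only [ENNReal.toReal_one] at this
            simp only [Set.mem_ofPred_eq, Set.mem_empty_iff_false, iff_false]
            linarith
          simp [hempty]
    _ = _ := by
        rw [lintegral_add_right _ (measurable_const.indicator measurableSet_Iio),
          lintegral_indicator_const measurableSet_Iio, Measure.restrict_apply measurableSet_Iio,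
          Set.Iio_inter_Ioi, Real.volume_Ioo]
        simp

theorem lintegral_lintegral_le_add_tvDist {S A : Type*} [MeasurableSpace S] [MeasurableSpace A]
    {f : S × A → ENNReal} (hf : Measurable f) (hf1 : ∀ q, f q ≤ 1)
    {π π' : S → Measure A} (hπ'meas : Measurable π')
    (hπprob : ∀ s, IsProbabilityMeasure (π s)) (hπ'prob : ∀ s, IsProbabilityMeasure (π' s))
    {δ : ℝ} (hδ : ∀ s, tvDist (π s) (π' s) ≤ δ)
    (μ ν : Measure S) [IsProbabilityMeasure μ] [IsProbabilityMeasure ν] :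
    ∫⁻ s, ∫⁻ a, f (s, a) ∂(π s) ∂μ ≤
      ∫⁻ s, ∫⁻ a, f (s, a) ∂(π' s) ∂ν + ENNReal.ofReal (tvDist μ ν) + ENNReal.ofReal δ := by
  let κ : ProbabilityTheory.Kernel S A := ⟨π', hπ'meas⟩
  have : ProbabilityTheory.IsMarkovKernel κ := ⟨hπ'prob⟩
  have hmeas : Measurable fun s => ∫⁻ a, f (s, a) ∂(π' s) :=
    Measurable.lintegral_kernel_prod_right (κ := κ) hf
  have hle (s : S) : ∫⁻ a, f (s, a) ∂(π' s) ≤ 1 :=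
    (lintegral_mono fun a => hf1 (s, a)).trans_eq (by simp)
  calc ∫⁻ s, ∫⁻ a, f (s, a) ∂(π s) ∂μ
      ≤ ∫⁻ s, (∫⁻ a, f (s, a) ∂(π' s) + ENNReal.ofReal δ) ∂μ := by
        refine lintegral_mono fun s => ?_
        refine (lintegral_le_add_tvDist (π s) (π' s) (hf.comp measurable_prodMk_left)
          fun a => hf1 (s, a)).trans ?_
        gcongr
        · exact le_rfl
        · exact hδ s
    _ = ∫⁻ s, ∫⁻ a, f (s, a) ∂(π' s) ∂μ + ENNReal.ofReal δ := by
        rw [lintegral_add_right _ measurable_const]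
        simp
    _ ≤ _ := by
        gcongr
        exact lintegral_le_add_tvDist μ ν hmeas hle

/-- recursion step in the paper's proof of Lemma 10. One-step
total-variation perturbation bound: if the policies `π, π'` satisfy
`d_TV(π(s), π'(s)) ≤ δ` for every state `s`, then the one-step distributions
`μ'(B) = ∫_S ∫_A K(s,a)(B) dπ(s) dμ` and `ν'(B) = ∫_S ∫_A K(s,a)(B) dπ'(s) dν`
satisfy `d_TV(μ', ν') ≤ δ + d_TV(μ, ν)`. -/
theorem one_step_tv_perturbation {S A : Type*} [MeasurableSpace S] [MeasurableSpace A]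
    (K : S × A → Measure S) (hKmeas : Measurable K)
    (hKprob : ∀ q, IsProbabilityMeasure (K q))
    (π π' : S → Measure A) (hπmeas : Measurable π) (hπ'meas : Measurable π')
    (hπprob : ∀ s, IsProbabilityMeasure (π s)) (hπ'prob : ∀ s, IsProbabilityMeasure (π' s))
    (δ : ℝ) (hδ : ∀ s, tvDist (π s) (π' s) ≤ δ)
    (μ ν : Measure S) [IsProbabilityMeasure μ] [IsProbabilityMeasure ν]
    (μ' ν' : Set S → ℝ)
    (hμ' : ∀ B : Set S, μ' B = (∫⁻ s, ∫⁻ a, K (s, a) B ∂(π s) ∂μ).toReal)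
    (hν' : ∀ B : Set S, ν' B = (∫⁻ s, ∫⁻ a, K (s, a) B ∂(π' s) ∂ν).toReal) :
    (⨆ B : {B : Set S // MeasurableSet B}, |μ' B.1 - ν' B.1|) ≤ δ + tvDist μ ν := by
  obtain ⟨s₀⟩ : Nonempty S := nonempty_of_isProbabilityMeasure μ
  have hδ0 : 0 ≤ δ := (tvDist_nonneg _ _).trans (hδ s₀)
  have htv := tvDist_nonneg μ ν
  have : Nonempty {B : Set S // MeasurableSet B} := ⟨⟨∅, MeasurableSet.empty⟩⟩
  refine ciSup_le fun ⟨B, hB⟩ => ?_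
  have hf : Measurable fun q => K q B := (Measure.measurable_coe hB).comp hKmeas
  have hf1 (q : S × A) : K q B ≤ 1 := prob_le_one
  have finite {ρ : S → Measure A} (hρ : ∀ s, IsProbabilityMeasure (ρ s)) (τ : Measure S)
      [IsProbabilityMeasure τ] : ∫⁻ s, ∫⁻ a, K (s, a) B ∂(ρ s) ∂τ ≠ ⊤ := by
    refine ne_top_of_le_ne_top ENNReal.one_ne_top ?_
    calc ∫⁻ s, ∫⁻ a, K (s, a) B ∂(ρ s) ∂τ
        ≤ ∫⁻ s, ∫⁻ _, 1 ∂(ρ s) ∂τ := lintegral_mono fun s => lintegral_mono fun a => hf1 (s, a)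
      _ = 1 := by simp
  have toReal_le {x y : ENNReal} (hy : y ≠ ⊤)
      (h : x ≤ y + ENNReal.ofReal (tvDist μ ν) + ENNReal.ofReal δ) :
      x.toReal ≤ y.toReal + tvDist μ ν + δ := by
    have h' := ENNReal.toReal_mono (by finiteness) h
    rwa [ENNReal.toReal_add (by finiteness) (by finiteness),
      ENNReal.toReal_add hy (by finiteness), ENNReal.toReal_ofReal htv,
      ENNReal.toReal_ofReal hδ0] at h'
  have h₁ := toReal_le (finite hπ'prob ν)
    (lintegral_lintegral_le_add_tvDist hf hf1 hπ'meas hπprob hπ'prob hδ μ ν)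
  have h₂ := toReal_le (finite hπprob μ) (tvDist_comm ν μ ▸
    lintegral_lintegral_le_add_tvDist hf hf1 hπmeas hπ'prob hπprob
      (fun s => tvDist_comm (π s) (π' s) ▸ hδ s) ν μ)
  rw [hμ', hν', abs_le]
  constructor <;> linarith
end
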